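/- There exists an absolute constant C > 0 such that the following deterministic bound holds. Let X ∈ ℝ^{n×p}, θ* ∈ ℝ^p, λ ∈ ℝ, 0 ≤ k ≤ min(n,p), Σ = diag(λ₁,…,λ_p) with λ₁ ≥ … ≥ λ_p > 0, Σ_{0:k} = diag(λ₁,…,λ_k), Σ_{k:∞} = diag(λ_{k+1},…,λ_p), A := λI_n + XX^⊤, A_k := λI_n + X_{k:∞}X_{k:∞}^⊤; assume A_k is positive definite and X_{0:k} has rank k. Then ‖(I_p − X^⊤A^{−1}X)θ*‖²_Σ ≤ C·[ ‖θ*_{k:∞}‖²_{Σ_{k:∞}} + (μ₁(A_k^{−1})²/μ_n(A_k^{−1})²)·( μ₁(Σ_{0:k}^{−1/2}X_{0:k}^⊤X_{0:k}Σ_{0:k}^{−1/2}) / μ_k(Σ_{0:k}^{−1/2}X_{0:k}^⊤X_{0:k}Σ_{0:k}^{−1/2})² )·‖X_{k:∞}θ*_{k:∞}‖² + ‖θ*_{0:k}‖²_{Σ_{0:k}^{−1}} / ( μ_n(A_k^{−1})²·μ_k(Σ_{0:k}^{−1/2}X_{0:k}^⊤X_{0:k}Σ_{0:k}^{−1/2})²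 ) + ‖X_{k:∞}Σ_{k:∞}X_{k:∞}^⊤‖·μ₁(A^{−1})²·‖X_{k:∞}θ*_{k:∞}‖² + ‖X_{k:∞}Σ_{k:∞}X_{k:∞}^⊤‖·(μ₁(A_k^{−1})²/μ_n(A_k^{−1})²)·( μ₁(Σ_{0:k}^{−1/2}X_{0:k}^⊤X_{0:k}Σ_{0:k}^{−1/2}) / μ_k(Σ_{0:k}^{−1/2}X_{0:k}^⊤X_{0:k}Σ_{0:k}^{−1/2})² )·‖Σ_{0:k}^{−1/2}θ*_{0:k}‖² ]. -/

import Mathlib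

open Matrix

noncomputable section

namespace RidgeOverparam

/-- The largest eigenvalue of a symmetric matrix, as the supremum of the Rayleigh quotient
over the unit sphere. -/
def muMax {m : ℕ} (M : Matrix (Fin m) (Fin m) ℝ) : ℝ :=
  sSup {r : ℝ | ∃ x : Fin m → ℝ, (∑ i, (x i) ^ 2) = 1 ∧ r = x ⬝ᵥ M.mulVec x}

/-- The smallest eigenvalue of a symmetric matrix, as the infimum of the Rayleigh quotient
over the unit sphere. -/
def muMin {m : ℕ} (M : Matrix (Fin m) (Fin m) ℝ) : ℝ :=
  sInf {r : ℝ | ∃ x : Fin m → ℝ, (∑ i, (x i) ^ 2) = 1 ∧ r = x ⬝ᵥ M.mulVec x}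

section RayleighQuotient

variable {m : ℕ}

lemma sum_sq_eq_dotProduct {ι : Type*} [Fintype ι] (x : ι → ℝ) :
    ∑ i, (x i) ^ 2 = x ⬝ᵥ x := by
  simp [dotProduct, sq]

lemma dotProduct_sq_le {ι : Type*} [Fintype ι] (x y : ι → ℝ) :
    (x ⬝ᵥ y) ^ 2 ≤ (x ⬝ᵥ x) * (y ⬝ᵥ y) := by
  rw [← sum_sq_eq_dotProduct, ← sum_sq_eq_dotProduct]
  exact Finset.sum_mul_sq_le_sq_mul_sq _ _ _

lemma dotProduct_self_nonneg' {ι : Type*} [Fintype ι] (x : ι → ℝ) : 0 ≤ x ⬝ᵥ x := by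
  rw [← sum_sq_eq_dotProduct]
  positivity

lemma dotProduct_self_add_le {ι : Type*} [Fintype ι] (x y : ι → ℝ) :
    (x + y) ⬝ᵥ (x + y) ≤ 2 * (x ⬝ᵥ x) + 2 * (y ⬝ᵥ y) := by
  have h := dotProduct_self_nonneg' (x - y)
  simp only [sub_dotProduct, dotProduct_sub, add_dotProduct, dotProduct_add] at h ⊢
  linarith

lemma dotProduct_self_sub_le {ι : Type*} [Fintype ι] (x y : ι → ℝ) :
    (x - y) ⬝ᵥ (x - y) ≤ 2 * (x ⬝ᵥ x) + 2 * (y ⬝ᵥ y) := by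
  have h := dotProduct_self_nonneg' (x + y)
  simp only [sub_dotProduct, dotProduct_sub, add_dotProduct, dotProduct_add] at h ⊢
  linarith

lemma isCompact_unitSphere : IsCompact {x : Fin m → ℝ | ∑ i, (x i) ^ 2 = 1} := by
  refine Metric.isCompact_of_isClosed_isBounded
    (isClosed_eq (by fun_prop) continuous_const) ?_
  refine (Metric.isBounded_closedBall (x := (0 : Fin m → ℝ)) (r := 1)).subset fun x hx => ?_
  rw [mem_closedBall_zero_iff, pi_norm_le_iff_of_nonneg zero_le_one]
  intro i
  rw [Real.norm_eq_abs, ← sq_le_one_iff_abs_le_one, ← (show ∑ i, (x i) ^ 2 = 1 from hx)]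
  exact Finset.single_le_sum (f := fun i => (x i) ^ 2) (fun j _ => sq_nonneg _)
    (Finset.mem_univ i)

lemma rayleighSet_eq_image (M : Matrix (Fin m) (Fin m) ℝ) :
    {r : ℝ | ∃ x : Fin m → ℝ, (∑ i, (x i) ^ 2) = 1 ∧ r = x ⬝ᵥ M.mulVec x} =
      (fun x => x ⬝ᵥ M.mulVec x) '' {x : Fin m → ℝ | ∑ i, (x i) ^ 2 = 1} := by
  ext r
  simp [eq_comm]

lemma isCompact_rayleighSet (M : Matrix (Fin m) (Fin m) ℝ) :
    IsCompact {r : ℝ | ∃ x : Fin m → ℝ, (∑ i, (x i) ^ 2) = 1 ∧ r = x ⬝ᵥ M.mulVec x} := by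
  rw [rayleighSet_eq_image]
  refine isCompact_unitSphere.image ?_
  simp only [dotProduct, mulVec]
  fun_prop

/-- Every quadratic form value is `x ⬝ᵥ x` times a value on the unit sphere. -/
lemma exists_unit_rayleigh (M : Matrix (Fin m) (Fin m) ℝ) {x : Fin m → ℝ} (hx : x ≠ 0) :
    ∃ y : Fin m → ℝ, ∑ i, (y i) ^ 2 = 1 ∧
      x ⬝ᵥ M.mulVec x = (y ⬝ᵥ M.mulVec y) * (x ⬝ᵥ x) := by
  have hpos : 0 < x ⬝ᵥ x :=
    lt_of_le_of_ne (dotProduct_self_nonneg' x) fun h => hx (dotProduct_self_eq_zero.1 h.symm)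
  have hs := Real.mul_self_sqrt hpos.le
  have hs0 : Real.sqrt (x ⬝ᵥ x) ≠ 0 := (Real.sqrt_pos.2 hpos).ne'
  refine ⟨(Real.sqrt (x ⬝ᵥ x))⁻¹ • x, ?_, ?_⟩
  · rw [sum_sq_eq_dotProduct, smul_dotProduct, dotProduct_smul, smul_eq_mul, smul_eq_mul]
    nth_rewrite 3 [← hs]
    field_simp
  · rw [mulVec_smul, smul_dotProduct, dotProduct_smul, smul_eq_mul, smul_eq_mul]
    generalize Real.sqrt (x ⬝ᵥ x) = s at hs hs0
    rw [← hs]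
    field_simp

lemma dotProduct_mulVec_le_muMax (M : Matrix (Fin m) (Fin m) ℝ) (x : Fin m → ℝ) :
    x ⬝ᵥ M.mulVec x ≤ muMax M * (x ⬝ᵥ x) := by
  by_cases hx : x = 0
  · simp [hx]
  obtain ⟨y, hy, hxy⟩ := exists_unit_rayleigh M hx
  rw [hxy]
  exact mul_le_mul_of_nonneg_right
    (le_csSup (isCompact_rayleighSet M).bddAbove ⟨y, hy, rfl⟩) (dotProduct_self_nonneg' x)

lemma muMin_mul_le_dotProduct_mulVec (M : Matrix (Fin m) (Fin m) ℝ) (x : Fin m → ℝ) :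
    muMin M * (x ⬝ᵥ x) ≤ x ⬝ᵥ M.mulVec x := by
  by_cases hx : x = 0
  · simp [hx]
  obtain ⟨y, hy, hxy⟩ := exists_unit_rayleigh M hx
  rw [hxy]
  exact mul_le_mul_of_nonneg_right
    (csInf_le (isCompact_rayleighSet M).bddBelow ⟨y, hy, rfl⟩) (dotProduct_self_nonneg' x)

lemma muMax_nonneg {M : Matrix (Fin m) (Fin m) ℝ} (hM : ∀ x, 0 ≤ x ⬝ᵥ M.mulVec x) :
    0 ≤ muMax M := by
  refine Real.sSup_nonneg ?_
  rintro r ⟨x, -, rfl⟩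
  exact hM x

lemma muMin_pos {M : Matrix (Fin m) (Fin m) ℝ} (hm : 0 < m)
    (hM : ∀ x, x ≠ 0 → 0 < x ⬝ᵥ M.mulVec x) : 0 < muMin M := by
  have hne : {r : ℝ | ∃ x : Fin m → ℝ, (∑ i, (x i) ^ 2) = 1 ∧
      r = x ⬝ᵥ M.mulVec x}.Nonempty :=
    ⟨_, Pi.single ⟨0, hm⟩ 1, by simp [sum_sq_eq_dotProduct], rfl⟩
  obtain ⟨x, hx, hr⟩ := (isCompact_rayleighSet M).sInf_mem hne
  rw [muMin, hr]
  refine hM x ?_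
  rintro rfl
  simp at hx

/-- A positive semidefinite matrix has operator norm at most its largest eigenvalue. -/
lemma mulVec_dotProduct_self_le {M : Matrix (Fin m) (Fin m) ℝ} (hM : M.PosSemidef)
    (x : Fin m → ℝ) :
    M.mulVec x ⬝ᵥ M.mulVec x ≤ muMax M ^ 2 * (x ⬝ᵥ x) := by
  have hnn : ∀ z, 0 ≤ z ⬝ᵥ M.mulVec z := fun z => by
    simpa using hM.dotProduct_mulVec_nonneg z
  obtain ⟨B, rfl⟩ : ∃ B : Matrix (Fin m) (Fin m) ℝ, M = Bᵀ * B := by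
    open scoped MatrixOrder in
    obtain ⟨B, hB⟩ := CStarAlgebra.nonneg_iff_eq_star_mul_self.1 hM.nonneg
    exact ⟨B, hB⟩
  have hform : ∀ y z, y ⬝ᵥ (Bᵀ * B).mulVec z = B.mulVec y ⬝ᵥ B.mulVec z := fun y z => by
    rw [← mulVec_mulVec, dotProduct_mulVec, vecMul_transpose]
  set M := Bᵀ * B
  set y := M.mulVec x with hy
  have hcs : (y ⬝ᵥ y) ^ 2 ≤ (muMax M * (y ⬝ᵥ y)) * (muMax M * (x ⬝ᵥ x)) := by
    calc (y ⬝ᵥ y) ^ 2 = (B.mulVec y ⬝ᵥ B.mulVec x) ^ 2 := by rw [← hform]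
      _ ≤ (y ⬝ᵥ M.mulVec y) * (x ⬝ᵥ M.mulVec x) := by
        rw [hform, hform]
        exact dotProduct_sq_le _ _
      _ ≤ _ := mul_le_mul (dotProduct_mulVec_le_muMax M y) (dotProduct_mulVec_le_muMax M x)
        (hnn x) (mul_nonneg (muMax_nonneg hnn) (dotProduct_self_nonneg' y))
  rcases (dotProduct_self_nonneg' y).eq_or_lt with h0 | h0
  · rw [← h0]
    exact mul_nonneg (sq_nonneg _) (dotProduct_self_nonneg' x)
  · exact le_of_mul_le_mul_left (by linarith) h0

lemma dotProduct_transpose_mul_self_mulVec {ι κ : Type*} [Fintype ι] [Fintype κ]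
    (Z : Matrix ι κ ℝ) (x : κ → ℝ) :
    x ⬝ᵥ (Zᵀ * Z).mulVec x = Z.mulVec x ⬝ᵥ Z.mulVec x := by
  rw [← mulVec_mulVec, dotProduct_mulVec, vecMul_transpose]

lemma transpose_mulVec_dotProduct_self_le {n : ℕ} (Z : Matrix (Fin n) (Fin m) ℝ)
    (x : Fin n → ℝ) :
    Zᵀ.mulVec x ⬝ᵥ Zᵀ.mulVec x ≤ muMax (Zᵀ * Z) * (x ⬝ᵥ x) := by
  set h := Zᵀ.mulVec x with hh
  have heq : h ⬝ᵥ h = x ⬝ᵥ Z.mulVec h := by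
    rw [dotProduct_mulVec x, ← mulVec_transpose]
  have hZ := dotProduct_mulVec_le_muMax (Zᵀ * Z) h
  rw [dotProduct_transpose_mul_self_mulVec] at hZ
  have hcs : (h ⬝ᵥ h) ^ 2 ≤ (x ⬝ᵥ x) * (muMax (Zᵀ * Z) * (h ⬝ᵥ h)) := by
    calc (h ⬝ᵥ h) ^ 2 = (x ⬝ᵥ Z.mulVec h) ^ 2 := by rw [← heq]
      _ ≤ (x ⬝ᵥ x) * (Z.mulVec h ⬝ᵥ Z.mulVec h) := dotProduct_sq_le _ _
      _ ≤ _ := mul_le_mul_of_nonneg_left hZ (dotProduct_self_nonneg' x)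
  rcases (dotProduct_self_nonneg' h).eq_or_lt with h0 | h0
  · rw [← h0]
    refine mul_nonneg (muMax_nonneg fun z => ?_) (dotProduct_self_nonneg' x)
    rw [dotProduct_transpose_mul_self_mulVec]
    exact dotProduct_self_nonneg' _
  · exact le_of_mul_le_mul_left (by linarith) h0

end RayleighQuotient

section Regularized

variable {n k q : ℕ}

/-- Coercivity of `D + ZᵀQZ`: a solution of `(D + ZᵀQZ) g = r` is controlled by `r`. -/
lemma dotProduct_self_le_of_regularized_eq {Q : Matrix (Fin n) (Fin n) ℝ}
    {Z : Matrix (Fin n) (Fin k) ℝ} {d g r : Fin k → ℝ} (hd : ∀ j, 0 ≤ d j)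
    (hQ : 0 < k → 0 < muMin Q) (hZ : 0 < k → 0 < muMin (Zᵀ * Z))
    (h : (diagonal d).mulVec g + Zᵀ.mulVec (Q.mulVec (Z.mulVec g)) = r) :
    g ⬝ᵥ g ≤ (r ⬝ᵥ r) / (muMin Q ^ 2 * muMin (Zᵀ * Z) ^ 2) := by
  rcases Nat.eq_zero_or_pos k with rfl | hk
  · simp
  have ha := hQ hk
  have hs := hZ hk
  have hD : 0 ≤ g ⬝ᵥ (diagonal d).mulVec g := by
    simp only [dotProduct, mulVec_diagonal]
    exact Finset.sum_nonneg fun j _ => by nlinarith [mul_nonneg (hd j) (mul_self_nonneg (g j))]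
  have hlow : muMin Q * muMin (Zᵀ * Z) * (g ⬝ᵥ g) ≤ g ⬝ᵥ r := by
    have h1 := muMin_mul_le_dotProduct_mulVec Q (Z.mulVec g)
    have h2 := muMin_mul_le_dotProduct_mulVec (Zᵀ * Z) g
    rw [dotProduct_transpose_mul_self_mulVec] at h2
    have h3 := mul_le_mul_of_nonneg_left h2 ha.le
    rw [← h, dotProduct_add, dotProduct_mulVec g Zᵀ, vecMul_transpose]
    linarith
  have hg := dotProduct_self_nonneg' g
  have hcs := dotProduct_sq_le g r
  have hsq : (muMin Q * muMin (Zᵀ * Z) * (g ⬝ᵥ g)) ^ 2 ≤ (g ⬝ᵥ g) * (r ⬝ᵥ r) :=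
    (pow_le_pow_left₀ (by positivity) hlow 2).trans hcs
  rw [le_div_iff₀ (by positivity)]
  rcases hg.eq_or_lt with h0 | h0
  · rw [← h0, zero_mul]
    exact dotProduct_self_nonneg' r
  · exact le_of_mul_le_mul_left (by linarith) h0

/-- The solution of `(Aₖ + X₀X₀ᵀ) v = X₀ θ₀ + y`, seen through the residual `θ₀ - X₀ᵀ v`. -/
lemma eq_inv_mulVec_residual {Ak : Matrix (Fin n) (Fin n) ℝ} (hAk : Ak.PosDef)
    {X0 : Matrix (Fin n) (Fin k) ℝ} {θ0 : Fin k → ℝ} {y v : Fin n → ℝ}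
    (hv : (Ak + X0 * X0ᵀ).mulVec v = X0.mulVec θ0 + y) :
    v = Ak⁻¹.mulVec (X0.mulVec (θ0 - X0ᵀ.mulVec v)) + Ak⁻¹.mulVec y := by
  have h : Ak.mulVec v = X0.mulVec (θ0 - X0ᵀ.mulVec v) + y := by
    rw [mulVec_sub, mulVec_mulVec]
    rw [add_mulVec] at hv
    rw [sub_add_eq_add_sub, ← hv, add_sub_cancel_right]
  rw [← mulVec_add, ← h, mulVec_mulVec,
    nonsing_inv_mul _ ((isUnit_iff_isUnit_det _).1 hAk.isUnit), one_mulVec]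

/-- The weighted residual `θ₀ - X₀ᵀ v` solves the regularized equation in the whitened
coordinates. -/
lemma whitened_residual_eq {Ak : Matrix (Fin n) (Fin n) ℝ} (hAk : Ak.PosDef)
    {X0 : Matrix (Fin n) (Fin k) ℝ} {θ0 : Fin k → ℝ} {y v : Fin n → ℝ}
    (hv : (Ak + X0 * X0ᵀ).mulVec v = X0.mulVec θ0 + y)
    {l g : Fin k → ℝ} (hg : (diagonal l).mulVec g = θ0 - X0ᵀ.mulVec v) :
    (diagonal fun j => l j * l j).mulVec g +
        (X0 * diagonal l)ᵀ.mulVec (Ak⁻¹.mulVec ((X0 * diagonal l).mulVec g)) =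
      (diagonal l).mulVec θ0 - (X0 * diagonal l)ᵀ.mulVec (Ak⁻¹.mulVec y) := by
  have h := eq_inv_mulVec_residual hAk hv
  have hres : (θ0 - X0ᵀ.mulVec v) +
      X0ᵀ.mulVec (Ak⁻¹.mulVec (X0.mulVec (θ0 - X0ᵀ.mulVec v))) =
        θ0 - X0ᵀ.mulVec (Ak⁻¹.mulVec y) := by
    have h' := congrArg X0ᵀ.mulVec h
    rw [mulVec_add] at h'
    rw [sub_add_eq_add_sub, sub_eq_sub_iff_add_eq_add, add_assoc, ← h']
  rw [← diagonal_mul_diagonal, transpose_mul, diagonal_transpose]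
  simp only [← mulVec_mulVec]
  rw [hg, ← mulVec_add, hres, mulVec_sub]

/-- The bias bound for a design split into two blocks. -/
lemma block_bias_bound {Ak : Matrix (Fin n) (Fin n) ℝ} (hAk : Ak.PosDef) (hkn : k ≤ n)
    {X0 : Matrix (Fin n) (Fin k) ℝ} (hX0 : X0.rank = k) (Xt : Matrix (Fin n) (Fin q) ℝ)
    (θ0 : Fin k → ℝ) (θt : Fin q → ℝ) {l0 : Fin k → ℝ} {lt : Fin q → ℝ}
    (hl0 : ∀ j, 0 < l0 j) (hlt : ∀ j, 0 < lt j)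
    {A : Matrix (Fin n) (Fin n) ℝ} (hA : A = Ak + X0 * X0ᵀ)
    {L : Matrix (Fin k) (Fin k) ℝ} (hL : L = diagonal fun j => (Real.sqrt (l0 j))⁻¹)
    {S : Matrix (Fin k) (Fin k) ℝ} (hS : S = L * X0ᵀ * X0 * L)
    {w0 : Fin k → ℝ} (hw0 : w0 = θ0 - X0ᵀ.mulVec (A⁻¹.mulVec (X0.mulVec θ0 + Xt.mulVec θt)))
    {wt : Fin q → ℝ} (hwt : wt = θt - Xtᵀ.mulVec (A⁻¹.mulVec (X0.mulVec θ0 + Xt.mulVec θt))) :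
    w0 ⬝ᵥ (diagonal l0).mulVec w0 + wt ⬝ᵥ (diagonal lt).mulVec wt ≤
      4 * (θt ⬝ᵥ (diagonal lt).mulVec θt
        + (muMax (Ak⁻¹) ^ 2 / muMin (Ak⁻¹) ^ 2) * (muMax S / muMin S ^ 2) *
            (Xt.mulVec θt ⬝ᵥ Xt.mulVec θt)
        + (L.mulVec θ0 ⬝ᵥ L.mulVec θ0) / (muMin (Ak⁻¹) ^ 2 * muMin S ^ 2)
        + muMax (Xt * diagonal lt * Xtᵀ) * muMax (A⁻¹) ^ 2 *
            (Xt.mulVec θt ⬝ᵥ Xt.mulVec θt)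
        + muMax (Xt * diagonal lt * Xtᵀ) *
            (muMax (Ak⁻¹) ^ 2 / muMin (Ak⁻¹) ^ 2) * (muMax S / muMin S ^ 2) *
            (L.mulVec θ0 ⬝ᵥ L.mulVec θ0)) := by
  have hAdef : A.PosDef := hA ▸ hAk.add_posSemidef (posSemidef_self_mul_conjTranspose X0)
  have hAunit : IsUnit A.det := (isUnit_iff_isUnit_det _).1 hAdef.isUnit
  set Z := X0 * L with hZ
  have hSZ : S = Zᵀ * Z := by
    rw [hS, hZ, transpose_mul, hL, diagonal_transpose]
    simp only [Matrix.mul_assoc]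
  have hSnn : 0 ≤ muMax S := by
    refine muMax_nonneg fun x => ?_
    rw [hSZ, dotProduct_transpose_mul_self_mulVec]
    exact dotProduct_self_nonneg' _
  have hinj : Function.Injective X0.mulVec := by
    have hker := X0.mulVecLin.finrank_range_add_finrank_ker
    rw [show Module.finrank ℝ X0.mulVecLin.range = k from hX0] at hker
    have h0 : Module.finrank ℝ X0.mulVecLin.ker = 0 := by simpa using hker
    exact LinearMap.ker_eq_bot.1 (Submodule.finrank_eq_zero.1 h0)
  have hl0' : ∀ j, 0 < Real.sqrt (l0 j) := fun j => Real.sqrt_pos.2 (hl0 j)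
  have hSpos : 0 < k → 0 < muMin (Zᵀ * Z) := fun hk => by
    refine muMin_pos hk fun x hx => ?_
    rw [dotProduct_transpose_mul_self_mulVec]
    refine lt_of_le_of_ne (dotProduct_self_nonneg' _) fun h => hx ?_
    have h1 := dotProduct_self_eq_zero.1 h.symm
    rw [hZ, ← mulVec_mulVec] at h1
    have h2 := hinj (h1.trans (mulVec_zero X0).symm)
    funext j
    have h3 := congrFun h2 j
    rw [hL, mulVec_diagonal] at h3
    simpa [(hl0' j).ne'] using h3
  have hQpos : 0 < k → 0 < muMin (Ak⁻¹) := fun hk =>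
    muMin_pos (hk.trans_le hkn) fun x hx => by
      simpa using hAk.inv.dotProduct_mulVec_pos hx
  have hd : ∀ j, 0 ≤ (Real.sqrt (l0 j))⁻¹ * (Real.sqrt (l0 j))⁻¹ :=
    fun j => mul_self_nonneg _
  have hsolve : ∀ y, (Ak + X0 * X0ᵀ).mulVec (A⁻¹.mulVec y) = y := fun y => by
    rw [← hA, mulVec_mulVec, mul_nonsing_inv _ hAunit, one_mulVec]
  have hwhite : ∀ e : Fin k → ℝ,
      L.mulVec (fun j => Real.sqrt (l0 j) * e j) = e := fun e => by
    funext j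
    rw [hL, mulVec_diagonal, inv_mul_cancel_left₀ (hl0' j).ne']
  set y := Xt.mulVec θt with hy
  set Q := Ak⁻¹ with hQ
  -- head coordinates
  have hhead : w0 ⬝ᵥ (diagonal l0).mulVec w0 ≤
      2 * ((L.mulVec θ0 ⬝ᵥ L.mulVec θ0) / (muMin Q ^ 2 * muMin S ^ 2)) +
      2 * ((muMax Q ^ 2 / muMin Q ^ 2) * (muMax S / muMin S ^ 2) * (y ⬝ᵥ y)) := by
    have hg : L.mulVec (fun j => Real.sqrt (l0 j) * w0 j) =
        θ0 - X0ᵀ.mulVec (A⁻¹.mulVec (X0.mulVec θ0 + y)) := (hwhite w0).trans hw0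
    have heq := whitened_residual_eq hAk (hsolve _) (hL ▸ hg)
    rw [← hL] at heq
    have hbd := dotProduct_self_le_of_regularized_eq hd hQpos hSpos heq
    have hnorm : w0 ⬝ᵥ (diagonal l0).mulVec w0 =
        (fun j => Real.sqrt (l0 j) * w0 j) ⬝ᵥ (fun j => Real.sqrt (l0 j) * w0 j) := by
      simp only [dotProduct, mulVec_diagonal]
      refine Finset.sum_congr rfl fun j _ => ?_
      linear_combination -(w0 j) ^ 2 * Real.mul_self_sqrt (hl0 j).le
    have hr : (L.mulVec θ0 - Zᵀ.mulVec (Q.mulVec y)) ⬝ᵥ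
        (L.mulVec θ0 - Zᵀ.mulVec (Q.mulVec y)) ≤
        2 * (L.mulVec θ0 ⬝ᵥ L.mulVec θ0) + 2 * (muMax S * (muMax Q ^ 2 * (y ⬝ᵥ y))) := by
      refine (dotProduct_self_sub_le _ _).trans ?_
      have h1 := transpose_mulVec_dotProduct_self_le Z (Q.mulVec y)
      rw [← hSZ] at h1
      have h2 := mul_le_mul_of_nonneg_left
        (mulVec_dotProduct_self_le hAk.inv.posSemidef y) hSnn
      linarith
    rw [hnorm]
    rw [← hSZ] at hbd
    refine (hbd.trans (div_le_div_of_nonneg_right hr (by positivity))).trans (le_of_eq ?_)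
    simp only [div_eq_mul_inv, mul_inv]
    ring
  -- contribution of the head signal to the tail coordinates
  have hcross : A⁻¹.mulVec (X0.mulVec θ0) ⬝ᵥ A⁻¹.mulVec (X0.mulVec θ0) ≤
      (muMax Q ^ 2 / muMin Q ^ 2) * (muMax S / muMin S ^ 2) *
        (L.mulVec θ0 ⬝ᵥ L.mulVec θ0) := by
    have hv : (Ak + X0 * X0ᵀ).mulVec (A⁻¹.mulVec (X0.mulVec θ0)) = X0.mulVec θ0 + 0 := by
      rw [hsolve, add_zero]
    set v := A⁻¹.mulVec (X0.mulVec θ0)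
    set e := θ0 - X0ᵀ.mulVec v with he
    set g : Fin k → ℝ := fun j => Real.sqrt (l0 j) * e j with hgdef
    have hg : L.mulVec g = e := hwhite e
    have heq := whitened_residual_eq hAk hv (hL ▸ hg)
    rw [← hL, mulVec_zero, mulVec_zero, sub_zero] at heq
    have hbd := dotProduct_self_le_of_regularized_eq hd hQpos hSpos heq
    rw [← hSZ] at hbd
    have hvQ : v = Q.mulVec (Z.mulVec g) := by
      have h := eq_inv_mulVec_residual hAk hv
      rw [mulVec_zero, add_zero, ← he] at h
      rw [h, hZ, ← mulVec_mulVec, hg]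
    have h1 := mulVec_dotProduct_self_le hAk.inv.posSemidef (Z.mulVec g)
    have h2 := dotProduct_mulVec_le_muMax S g
    rw [hSZ, dotProduct_transpose_mul_self_mulVec, ← hSZ] at h2
    rw [hvQ]
    calc _ ≤ muMax Q ^ 2 * (Z.mulVec g ⬝ᵥ Z.mulVec g) := h1
      _ ≤ muMax Q ^ 2 * (muMax S *
          ((L.mulVec θ0 ⬝ᵥ L.mulVec θ0) / (muMin Q ^ 2 * muMin S ^ 2))) :=
        mul_le_mul_of_nonneg_left (h2.trans (mul_le_mul_of_nonneg_left hbd hSnn))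
          (sq_nonneg _)
      _ = _ := by
        simp only [div_eq_mul_inv, mul_inv]
        ring
  -- tail coordinates
  set T := Xt * diagonal lt * Xtᵀ with hT
  have hTform : ∀ v, v ⬝ᵥ T.mulVec v =
      Xtᵀ.mulVec v ⬝ᵥ (diagonal lt).mulVec (Xtᵀ.mulVec v) := fun v => by
    rw [hT, ← mulVec_mulVec, ← mulVec_mulVec, dotProduct_mulVec, mulVec_transpose]
  have hdiag : ∀ a : Fin q → ℝ, 0 ≤ a ⬝ᵥ (diagonal lt).mulVec a := fun a => by
    simp only [dotProduct, mulVec_diagonal]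
    exact Finset.sum_nonneg fun j _ => by
      nlinarith [mul_nonneg (hlt j).le (mul_self_nonneg (a j))]
  have hsub : ∀ a b : Fin q → ℝ, (a - b) ⬝ᵥ (diagonal lt).mulVec (a - b) ≤
      2 * (a ⬝ᵥ (diagonal lt).mulVec a) + 2 * (b ⬝ᵥ (diagonal lt).mulVec b) := fun a b => by
    have h := hdiag (a + b)
    simp only [mulVec_add, mulVec_sub, sub_dotProduct, dotProduct_sub, add_dotProduct,
      dotProduct_add] at h ⊢
    linarith
  have hTnn : 0 ≤ muMax T := muMax_nonneg fun v => hTform v ▸ hdiag _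
  have htail : wt ⬝ᵥ (diagonal lt).mulVec wt ≤
      2 * (θt ⬝ᵥ (diagonal lt).mulVec θt) +
      4 * (muMax T * (muMax Q ^ 2 / muMin Q ^ 2) * (muMax S / muMin S ^ 2) *
        (L.mulVec θ0 ⬝ᵥ L.mulVec θ0)) +
      4 * (muMax T * muMax (A⁻¹) ^ 2 * (y ⬝ᵥ y)) := by
    rw [hwt]
    refine (hsub _ _).trans ?_
    rw [← hTform]
    have h1 := dotProduct_mulVec_le_muMax T (A⁻¹.mulVec (X0.mulVec θ0 + y))
    have h2 := dotProduct_self_add_le (A⁻¹.mulVec (X0.mulVec θ0)) (A⁻¹.mulVec y)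
    rw [← mulVec_add] at h2
    have h3 := mulVec_dotProduct_self_le hAdef.inv.posSemidef y
    have h4 := mul_le_mul_of_nonneg_left
      (h2.trans (add_le_add (mul_le_mul_of_nonneg_left hcross zero_le_two)
        (mul_le_mul_of_nonneg_left h3 zero_le_two))) hTnn
    linarith
  have hLθ := dotProduct_self_nonneg' (L.mulVec θ0)
  have hyy := dotProduct_self_nonneg' y
  have hT1 := hdiag θt
  have hT2 : 0 ≤ (muMax Q ^ 2 / muMin Q ^ 2) * (muMax S / muMin S ^ 2) * (y ⬝ᵥ y) := by
    positivity
  have hT3 : 0 ≤ (L.mulVec θ0 ⬝ᵥ L.mulVec θ0) / (muMin Q ^ 2 * muMin S ^ 2) := by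
    positivity
  linarith

end Regularized

lemma sum_fin_split {p k : ℕ} (hkp : k ≤ p) (f : Fin p → ℝ) :
    ∑ i, f i = ∑ j : Fin k, f (Fin.castLE hkp j) +
      ∑ j : Fin (p - k), f ⟨k + (j : ℕ), by have := j.isLt; omega⟩ := by
  rw [← (finCongr (Nat.add_sub_cancel' hkp)).sum_comp, Fin.sum_univ_add]
  rfl

/-- deterministic upper bound on the bias term `‖(I_p − XᵀA⁻¹X)θ*‖²_Σ`. -/
theorem bias_term_decomposition_bound :
    ∃ C : ℝ, 0 < C ∧
      ∀ (n p k : ℕ) (_hkn : k ≤ n) (hkp : k ≤ p)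
        (X : Matrix (Fin n) (Fin p) ℝ) (θ : Fin p → ℝ) (lam : ℝ)
        (lambda_ : Fin p → ℝ), (∀ i, 0 < lambda_ i) → Antitone lambda_ →
        let X0k : Matrix (Fin n) (Fin k) ℝ := Matrix.of fun i j => X i (Fin.castLE hkp j)
        let Xtail : Matrix (Fin n) (Fin (p - k)) ℝ :=
          Matrix.of fun i j => X i ⟨k + (j : ℕ), by have := j.isLt; omega⟩
        let θ0k : Fin k → ℝ := fun j => θ (Fin.castLE hkp j)
        let θtail : Fin (p - k) → ℝ := fun j => θ ⟨k + (j : ℕ), by have := j.isLt; omega⟩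
        let Sig0kInvSqrt : Matrix (Fin k) (Fin k) ℝ :=
          Matrix.diagonal fun j => (Real.sqrt (lambda_ (Fin.castLE hkp j)))⁻¹
        let Sigtail : Matrix (Fin (p - k)) (Fin (p - k)) ℝ :=
          Matrix.diagonal fun j => lambda_ ⟨k + (j : ℕ), by have := j.isLt; omega⟩
        let A : Matrix (Fin n) (Fin n) ℝ := lam • (1 : Matrix (Fin n) (Fin n) ℝ) + X * Xᵀ
        let Ak : Matrix (Fin n) (Fin n) ℝ :=
          lam • (1 : Matrix (Fin n) (Fin n) ℝ) + Xtail * Xtailᵀ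
        Ak.PosDef → X0k.rank = k →
        let S : Matrix (Fin k) (Fin k) ℝ := Sig0kInvSqrt * X0kᵀ * X0k * Sig0kInvSqrt
        let w : Fin p → ℝ := ((1 : Matrix (Fin p) (Fin p) ℝ) - Xᵀ * A⁻¹ * X).mulVec θ
        w ⬝ᵥ (Matrix.diagonal lambda_).mulVec w ≤
          C * ((θtail ⬝ᵥ Sigtail.mulVec θtail)
            + (muMax (Ak⁻¹) ^ 2 / muMin (Ak⁻¹) ^ 2) * (muMax S / muMin S ^ 2) *
                (∑ i, (Xtail.mulVec θtail i) ^ 2)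
            + (∑ j, (θ0k j) ^ 2 / lambda_ (Fin.castLE hkp j)) /
                (muMin (Ak⁻¹) ^ 2 * muMin S ^ 2)
            + muMax (Xtail * Sigtail * Xtailᵀ) * muMax (A⁻¹) ^ 2 *
                (∑ i, (Xtail.mulVec θtail i) ^ 2)
            + muMax (Xtail * Sigtail * Xtailᵀ) *
                (muMax (Ak⁻¹) ^ 2 / muMin (Ak⁻¹) ^ 2) * (muMax S / muMin S ^ 2) *
                (∑ j, (Sig0kInvSqrt.mulVec θ0k j) ^ 2)) := by
  refine ⟨4, by norm_num, ?_⟩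
  intro n p k hkn hkp X θ lam lambda_ hpos _ X0k Xtail θ0k θtail Sig0kInvSqrt Sigtail A Ak
    hAk hrank S w
  have hXX : X * Xᵀ = X0k * X0kᵀ + Xtail * Xtailᵀ := by
    ext i j
    exact sum_fin_split hkp fun l => X i l * X j l
  have hXθ : X.mulVec θ = X0k.mulVec θ0k + Xtail.mulVec θtail := by
    funext i
    exact sum_fin_split hkp fun l => X i l * θ l
  have hA : A = Ak + X0k * X0kᵀ := by
    simp only [A, Ak, hXX]
    abel
  have hw : w = θ - Xᵀ.mulVec (A⁻¹.mulVec (X0k.mulVec θ0k + Xtail.mulVec θtail)) := by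
    simp only [w, sub_mulVec, one_mulVec, ← mulVec_mulVec, hXθ]
  have hbound := block_bias_bound hAk hkn hrank Xtail θ0k θtail
    (l0 := fun j => lambda_ (Fin.castLE hkp j))
    (lt := fun j => lambda_ ⟨k + (j : ℕ), by have := j.isLt; omega⟩)
    (fun j => hpos _) (fun j => hpos _) hA (L := Sig0kInvSqrt) rfl (S := S) rfl
    (w0 := fun j => w (Fin.castLE hkp j))
    (wt := fun j => w ⟨k + (j : ℕ), by have := j.isLt; omega⟩)
    (by rw [hw]; rfl) (by rw [hw]; rfl)
  have hθ0 : ∑ j, (θ0k j) ^ 2 / lambda_ (Fin.castLE hkp j) =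
      Sig0kInvSqrt.mulVec θ0k ⬝ᵥ Sig0kInvSqrt.mulVec θ0k := by
    rw [← sum_sq_eq_dotProduct]
    refine Finset.sum_congr rfl fun j _ => ?_
    simp only [Sig0kInvSqrt, mulVec_diagonal, mul_pow, inv_pow, Real.sq_sqrt (hpos _).le]
    rw [div_eq_inv_mul]
  rw [hθ0, sum_sq_eq_dotProduct, sum_sq_eq_dotProduct]
  refine (le_of_eq ?_).trans hbound
  simp only [dotProduct, mulVec_diagonal]
  exact sum_fin_split hkp fun i => w i * (lambda_ i * w i)

end RidgeOverparam
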